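/- For k = 1, 2, 3, 4, 5, the real vector space of invariant alternating k-forms on V has dimension 2, 4, 6, 9 and 12, respectively. -/

import Mathlib

/-- The model tangent space: a 10-dimensional real vector space with standard basis
`e₀, e₁, e₂, e₃, f₀, f₁, f₂, f₃, p, q` corresponding to the coordinates `0, …, 9`. -/
abbrev V10 : Type := Fin 10 → ℝ

/-- The action of `ad_{E_{α₁}}` on the tangent space `m` of the adjoint orbit
`G₂/GL₂(ℝ)`:  `X e₀ = e₁`, `X e₁ = 2e₂`, `X e₂ = 3e₃`, `X e₃ = 0`, `X f₀ = 0`,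
`X f₁ = -3f₀`, `X f₂ = -2f₁`, `X f₃ = -f₂`, `X p = X q = 0`. -/
noncomputable def Xop : V10 →ₗ[ℝ] V10 :=
  Matrix.toLin' (Matrix.of fun i j : Fin 10 =>
    if i = 1 ∧ j = 0 then (1 : ℝ) else
    if i = 2 ∧ j = 1 then 2 else
    if i = 3 ∧ j = 2 then 3 else
    if i = 4 ∧ j = 5 then -3 else
    if i = 5 ∧ j = 6 then -2 else
    if i = 6 ∧ j = 7 then -1 else 0)

/-- The action of `ad_{E_{-α₁}}`:  `Y e₀ = 0`, `Y e₁ = 3e₀`, `Y e₂ = 2e₁`, `Y e₃ = e₂`,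
`Y f₀ = -f₁`, `Y f₁ = -2f₂`, `Y f₂ = -3f₃`, `Y f₃ = 0`, `Y p = Y q = 0`. -/
noncomputable def Yop : V10 →ₗ[ℝ] V10 :=
  Matrix.toLin' (Matrix.of fun i j : Fin 10 =>
    if i = 0 ∧ j = 1 then (3 : ℝ) else
    if i = 1 ∧ j = 2 then 2 else
    if i = 2 ∧ j = 3 then 1 else
    if i = 5 ∧ j = 4 then -1 else
    if i = 6 ∧ j = 5 then -2 else
    if i = 7 ∧ j = 6 then -3 else 0)

/-- The dual basis covectors `e₀*, …, e₃*, f₀*, …, f₃*, p*, q*` (coordinate projections):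
`dual 0, …, dual 3` are `e₀*, …, e₃*`; `dual 4, …, dual 7` are `f₀*, …, f₃*`;
`dual 8 = p*` and `dual 9 = q*`. -/
noncomputable def dual (i : Fin 10) : V10 →ₗ[ℝ] ℝ := LinearMap.proj i

/-- The wedge product `ξ₁ ∧ ⋯ ∧ ξ_k` of covectors, as the alternating `k`-form
`(v₁, …, v_k) ↦ det (ξ i (v j))`. -/
noncomputable def wdg {k : ℕ} (ξ : Fin k → (V10 →ₗ[ℝ] ℝ)) : AlternatingMap ℝ V10 ℝ (Fin k) :=
  (Matrix.detRowAlternating).compLinearMap (LinearMap.pi ξ)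

/-- The Lie derivative of the alternating `k`-form `ω` along the endomorphism `A`
vanishes: `Σ_{i} ω (v₁, …, A vᵢ, …, v_k) = 0` for all `v₁, …, v_k`. -/
def LieDerivZero {k : ℕ} (A : V10 →ₗ[ℝ] V10) (ω : AlternatingMap ℝ V10 ℝ (Fin k)) : Prop :=
  ∀ v : Fin k → V10, ∑ i, ω (Function.update v i (A (v i))) = 0

/-- An alternating `k`-form on `V10` is invariant if its Lie derivative along both `X`
and `Y` vanishes. -/
def IsInv {k : ℕ} (ω : AlternatingMap ℝ V10 ℝ (Fin k)) : Prop :=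
  LieDerivZero Xop ω ∧ LieDerivZero Yop ω

/-- The subspace of invariant alternating `k`-forms on `V10`. -/
noncomputable def invSubmodule (k : ℕ) : Submodule ℝ (AlternatingMap ℝ V10 ℝ (Fin k)) where
  carrier := {ω | IsInv ω}
  zero_mem' := ⟨fun v => by simp, fun v => by simp⟩
  add_mem' := by
    rintro a b ⟨hax, hay⟩ ⟨hbx, hby⟩
    refine ⟨fun v => ?_, fun v => ?_⟩
    · simp only [AlternatingMap.add_apply, Finset.sum_add_distrib, hax v, hbx v, add_zero]
    · simp only [AlternatingMap.add_apply, Finset.sum_add_distrib, hay v, hby v, add_zero]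
  smul_mem' := by
    rintro c a ⟨hax, hay⟩
    refine ⟨fun v => ?_, fun v => ?_⟩
    · simp only [AlternatingMap.smul_apply, smul_eq_mul, ← Finset.mul_sum, hax v, mul_zero]
    · simp only [AlternatingMap.smul_apply, smul_eq_mul, ← Finset.mul_sum, hay v, mul_zero]

instance (n : ℕ) : FiniteDimensional ℝ (V10 [⋀^Fin n]→ₗ[ℝ] ℝ) :=
  Module.Finite.of_injective
    (AlternatingMap.toMultilinearMapLM (R := ℝ) (S := ℝ) (M := V10) (N := ℝ) (ι := Fin n))
    AlternatingMap.coe_multilinearMap_injective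

/-- The exterior product `ξ ∧ η` of a covector `ξ` and an alternating form `η`. -/
noncomputable def covecWedge {n : ℕ} (ξ : V10 →ₗ[ℝ] ℝ) :
    (V10 [⋀^Fin n]→ₗ[ℝ] ℝ) →ₗ[ℝ] (V10 [⋀^Fin (n + 1)]→ₗ[ℝ] ℝ) :=
  AlternatingMap.alternatizeUncurryFinLM ∘ₗ LinearMap.smulRightₗ ξ

theorem covecWedge_apply {n : ℕ} (ξ : V10 →ₗ[ℝ] ℝ) (η : V10 [⋀^Fin n]→ₗ[ℝ] ℝ)
    (v : Fin (n + 1) → V10) :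
    covecWedge ξ η v = ∑ i : Fin (n + 1), (-1) ^ (i : ℕ) * (ξ (v i) * η (i.removeNth v)) := by
  simp [covecWedge, AlternatingMap.alternatizeUncurryFin_apply]

theorem covecWedge_self {n : ℕ} (ξ : V10 →ₗ[ℝ] ℝ) (η : V10 [⋀^Fin n]→ₗ[ℝ] ℝ) :
    covecWedge ξ (covecWedge ξ η) = 0 := by
  have := AlternatingMap.alternatizeUncurryFin_alternatizeUncurryFinLM_comp_of_symmetric
    (f := ξ.smulRight (ξ.smulRight η)) fun x y => by simp [smul_smul, mul_comm]
  rw [← this]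
  ext v
  simp [covecWedge, AlternatingMap.alternatizeUncurryFin_apply]

theorem covecWedge_smul_left {n : ℕ} (c : ℝ) (ξ : V10 →ₗ[ℝ] ℝ) (η : V10 [⋀^Fin n]→ₗ[ℝ] ℝ) :
    covecWedge (c • ξ) η = c • covecWedge ξ η := by
  ext v
  simp only [covecWedge_apply, AlternatingMap.smul_apply, smul_eq_mul, Finset.mul_sum,
    LinearMap.smul_apply]
  exact Finset.sum_congr rfl fun i _ => by ring

theorem covecWedge_zero_left {n : ℕ} (η : V10 [⋀^Fin n]→ₗ[ℝ] ℝ) :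
    covecWedge 0 η = 0 := by
  ext v
  simp [covecWedge_apply]

/-- The value `Σᵢ ω (v₁, …, A vᵢ, …, v_k)` of the Lie derivative of `ω` along `A`. -/
noncomputable def lieDeriv {k : ℕ} (A : V10 →ₗ[ℝ] V10) :
    (V10 [⋀^Fin k]→ₗ[ℝ] ℝ) →ₗ[ℝ] (Fin k → V10) → ℝ where
  toFun ω v := ∑ i, ω (Function.update v i (A (v i)))
  map_add' ω η := by ext v; simp [Finset.sum_add_distrib]
  map_smul' c ω := by ext v; simp [Finset.mul_sum]

theorem lieDeriv_apply {k : ℕ} (A : V10 →ₗ[ℝ] V10) (ω : V10 [⋀^Fin k]→ₗ[ℝ] ℝ)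
    (v : Fin k → V10) : lieDeriv A ω v = ∑ i, ω (Function.update v i (A (v i))) := rfl

theorem lieDeriv_eq_zero_iff {k : ℕ} {A : V10 →ₗ[ℝ] V10} {ω : V10 [⋀^Fin k]→ₗ[ℝ] ℝ} :
    lieDeriv A ω = 0 ↔ LieDerivZero A ω := funext_iff

/-- The Leibniz rule for the exterior product with a covector. -/
theorem lieDeriv_covecWedge {n : ℕ} (A : V10 →ₗ[ℝ] V10) (ξ : V10 →ₗ[ℝ] ℝ)
    (η : V10 [⋀^Fin n]→ₗ[ℝ] ℝ) (v : Fin (n + 1) → V10) :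
    lieDeriv A (covecWedge ξ η) v = covecWedge (ξ ∘ₗ A) η v +
      ∑ j : Fin (n + 1), (-1) ^ (j : ℕ) * (ξ (v j) * lieDeriv A η (j.removeNth v)) := by
  simp only [lieDeriv_apply, covecWedge_apply]
  rw [Finset.sum_comm, ← Finset.sum_add_distrib]
  refine Finset.sum_congr rfl fun j _ => ?_
  rw [Fin.sum_univ_succAbove _ j]
  simp [Fin.removeNth_apply, Finset.mul_sum, Function.update_of_ne, Fin.ne_succAbove]

theorem lieDeriv_covecWedge_of_lieDeriv_eq_zero {n : ℕ} {A : V10 →ₗ[ℝ] V10}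
    {η : V10 [⋀^Fin n]→ₗ[ℝ] ℝ} (hη : lieDeriv A η = 0) (ξ : V10 →ₗ[ℝ] ℝ) :
    lieDeriv A (covecWedge ξ η) = covecWedge (ξ ∘ₗ A) η := by
  ext v
  simp [lieDeriv_covecWedge, hη]

theorem lieDeriv_covecWedge_covecWedge {n : ℕ} {A : V10 →ₗ[ℝ] V10}
    {η : V10 [⋀^Fin n]→ₗ[ℝ] ℝ} (hη : lieDeriv A η = 0) (ξ ζ : V10 →ₗ[ℝ] ℝ) :
    lieDeriv A (covecWedge ξ (covecWedge ζ η)) =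
      covecWedge (ξ ∘ₗ A) (covecWedge ζ η) + ⇑(covecWedge ξ (covecWedge (ζ ∘ₗ A) η)) := by
  ext v
  rw [lieDeriv_covecWedge, lieDeriv_covecWedge_of_lieDeriv_eq_zero hη, Pi.add_apply,
    covecWedge_apply ξ]

/-- Forms killed by the Lie derivatives along `A` and `B` are killed by the one along `[A, B]`. -/
theorem LieDerivZero.commutator {k : ℕ} {A B : V10 →ₗ[ℝ] V10} {ω : V10 [⋀^Fin k]→ₗ[ℝ] ℝ}
    (hA : LieDerivZero A ω) (hB : LieDerivZero B ω) : LieDerivZero (A ∘ₗ B - B ∘ₗ A) ω := by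
  intro v
  have key : ∀ (C D : V10 →ₗ[ℝ] V10), LieDerivZero D ω →
      ∑ i, ω (Function.update v i (D (C (v i)))) + ∑ i, ∑ j ∈ Finset.univ.erase i,
        ω (Function.update (Function.update v i (C (v i))) j (D (v j))) = 0 := by
    intro C D hD
    rw [← Finset.sum_add_distrib]
    refine Finset.sum_eq_zero fun i _ => ?_
    rw [← hD (Function.update v i (C (v i))), ← Finset.add_sum_erase _ _ (Finset.mem_univ i)]
    congr 1
    · simp
    · refine Finset.sum_congr rfl fun j hj => ?_
      rw [Function.update_of_ne (Finset.ne_of_mem_erase hj)]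
  have swap : ∑ i, ∑ j ∈ Finset.univ.erase i,
        ω (Function.update (Function.update v i (A (v i))) j (B (v j))) =
      ∑ i, ∑ j ∈ Finset.univ.erase i,
        ω (Function.update (Function.update v i (B (v i))) j (A (v j))) := by
    rw [Finset.sum_comm' (t' := Finset.univ) (s' := fun j => Finset.univ.erase j)
      (by simp [eq_comm])]
    refine Finset.sum_congr rfl fun j _ => Finset.sum_congr rfl fun i hi => ?_
    rw [Function.update_comm (Finset.ne_of_mem_erase hi)]
  have hAB := key A B hB
  have hBA := key B A hA
  simp only [LinearMap.sub_apply, LinearMap.comp_apply, AlternatingMap.map_update_sub,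
    Finset.sum_sub_distrib]
  linarith

/-- The alternating `n`-forms that vanish as soon as one of the arguments is `u`. -/
def horizontal (u : V10) (n : ℕ) : Submodule ℝ (V10 [⋀^Fin n]→ₗ[ℝ] ℝ) where
  carrier := {ω | ∀ v i, v i = u → ω v = 0}
  zero_mem' _ _ _ := rfl
  add_mem' hω hη v i h := by simp [hω v i h, hη v i h]
  smul_mem' c ω hω v i h := by simp [hω v i h]

theorem mem_horizontal_succ_iff {u : V10} {n : ℕ} {ω : V10 [⋀^Fin (n + 1)]→ₗ[ℝ] ℝ} :
    ω ∈ horizontal u (n + 1) ↔ ω.curryLeft u = 0 := by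
  constructor
  · intro h
    ext v
    exact h _ 0 rfl
  · rintro h v i rfl
    rw [← i.insertNth_self_removeNth v, AlternatingMap.map_insertNth,
      ← AlternatingMap.curryLeft_apply_apply, h]
    simp

theorem covecWedge_mem_horizontal {u : V10} {n : ℕ} {ξ : V10 →ₗ[ℝ] ℝ} (hξ : ξ u = 0)
    {η : V10 [⋀^Fin n]→ₗ[ℝ] ℝ} (hη : η ∈ horizontal u n) :
    covecWedge ξ η ∈ horizontal u (n + 1) := by
  rintro v i rfl
  rw [covecWedge_apply]
  refine Finset.sum_eq_zero fun j _ => ?_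
  rcases eq_or_ne i j with rfl | hij
  · simp [hξ]
  · obtain ⟨l, rfl⟩ := Fin.exists_succAbove_eq hij
    rw [hη _ l rfl]
    simp

theorem curryLeft_mem_horizontal {u w : V10} {n : ℕ} {ω : V10 [⋀^Fin (n + 1)]→ₗ[ℝ] ℝ}
    (hω : ω ∈ horizontal u (n + 1)) : ω.curryLeft w ∈ horizontal u n :=
  fun v i h => hω (Matrix.vecCons w v) i.succ h

theorem curryLeft_self_mem_horizontal (u : V10) {n : ℕ} (ω : V10 [⋀^Fin (n + 1)]→ₗ[ℝ] ℝ) :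
    ω.curryLeft u ∈ horizontal u n := fun v i h =>
  ω.map_eq_zero_of_eq (Matrix.vecCons u v) (i := 0) (j := i.succ) h.symm (Fin.succ_ne_zero i).symm

theorem curryLeft_covecWedge {u : V10} {n : ℕ} {ξ : V10 →ₗ[ℝ] ℝ} (hξ : ξ u = 1)
    {η : V10 [⋀^Fin n]→ₗ[ℝ] ℝ} (hη : η ∈ horizontal u n) :
    (covecWedge ξ η).curryLeft u = η := by
  ext v
  rw [AlternatingMap.curryLeft_apply_apply, covecWedge_apply, Fin.sum_univ_succ,
    Finset.sum_eq_zero]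
  · simp [hξ, Fin.tail_def]
  · intro i _
    obtain _ | n := n
    · exact i.elim0
    · rw [hη _ 0 (by simp [Fin.removeNth_apply])]
      simp

/-- A family of spaces of forms that is stable under contraction with `u` and exterior
multiplication by a covector `ξ` with `ξ u = 1` splits into its horizontal parts. -/
theorem finrank_eq_add_of_curryLeft_covecWedge (K : ∀ n, Submodule ℝ (V10 [⋀^Fin n]→ₗ[ℝ] ℝ))
    {u : V10} {ξ : V10 →ₗ[ℝ] ℝ} (hξ : ξ u = 1) (n : ℕ)
    (hι : ∀ ω ∈ K (n + 1), ω.curryLeft u ∈ K n)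
    (hw : ∀ η ∈ K n, covecWedge ξ η ∈ K (n + 1)) :
    Module.finrank ℝ (K (n + 1)) =
      Module.finrank ℝ ↥(K (n + 1) ⊓ horizontal u (n + 1)) +
        Module.finrank ℝ ↥(K n ⊓ horizontal u n) := by
  let ι : (V10 [⋀^Fin (n + 1)]→ₗ[ℝ] ℝ) →ₗ[ℝ] (V10 [⋀^Fin n]→ₗ[ℝ] ℝ) :=
    LinearMap.applyₗ u ∘ₗ AlternatingMap.curryLeftLinearMap
  have hker : LinearMap.ker ι = horizontal u (n + 1) := by
    ext ω
    rw [mem_horizontal_succ_iff]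
    rfl
  have hrange : (ι.domRestrict (K (n + 1))).range = K n ⊓ horizontal u n := by
    ext η
    constructor
    · rintro ⟨⟨ω, hω⟩, rfl⟩
      exact ⟨hι ω hω, curryLeft_self_mem_horizontal u ω⟩
    · rintro ⟨hη, hη'⟩
      exact ⟨⟨covecWedge ξ η, hw η hη⟩, curryLeft_covecWedge hξ hη'⟩
  have := LinearMap.finrank_range_add_finrank_ker (K := ℝ) (V := K (n + 1))
    (V₂ := V10 [⋀^Fin n]→ₗ[ℝ] ℝ) (ι.domRestrict (K (n + 1)))
  rw [hrange, LinearMap.ker_domRestrict, hker] at this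
  rw [← this, add_comm, ← Submodule.finrank_map_subtype_eq, Submodule.map_comap_subtype]

/-- The `i`-th standard basis vector of `V10`. -/
noncomputable def stdVec (i : Fin 10) : V10 := Pi.single i 1

theorem dual_stdVec (i j : Fin 10) : dual i (stdVec j) = if i = j then 1 else 0 := by
  simp [dual, stdVec, Pi.single_apply]

theorem linearMap_ext_stdVec {M : Type*} [AddCommMonoid M] [Module ℝ M] {f g : V10 →ₗ[ℝ] M}
    (h : ∀ i, f (stdVec i) = g (stdVec i)) : f = g :=
  LinearMap.pi_ext' fun i => LinearMap.ext_ring (h i)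

/-- `X` maps the `i`-th basis vector to `xCoeff i` times the `xNext i`-th one. -/
def xCoeff : Fin 10 → ℤ := ![1, 2, 3, 0, 0, -3, -2, -1, 0, 0]

/-- The index of the basis vector to which `X` maps the `i`-th one, up to a factor. -/
def xNext : Fin 10 → Fin 10 := ![1, 2, 3, 3, 4, 4, 5, 6, 8, 9]

/-- `Y` maps the `i`-th basis vector to `yCoeff i` times the `yNext i`-th one. -/
def yCoeff : Fin 10 → ℤ := ![0, 3, 2, 1, -1, -2, -3, 0, 0, 0]

/-- The index of the basis vector to which `Y` maps the `i`-th one, up to a factor. -/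
def yNext : Fin 10 → Fin 10 := ![0, 0, 1, 2, 5, 6, 7, 7, 8, 9]

theorem Xop_stdVec (i : Fin 10) : Xop (stdVec i) = (xCoeff i : ℝ) • stdVec (xNext i) := by
  ext j
  simp only [Xop, stdVec, Matrix.toLin'_apply, Matrix.mulVec_single_one, Matrix.col_apply,
    Matrix.of_apply, Pi.smul_apply, Pi.single_apply, smul_eq_mul]
  fin_cases i <;> fin_cases j <;> simp [xCoeff, xNext]

theorem Yop_stdVec (i : Fin 10) : Yop (stdVec i) = (yCoeff i : ℝ) • stdVec (yNext i) := by
  ext j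
  simp only [Yop, stdVec, Matrix.toLin'_apply, Matrix.mulVec_single_one, Matrix.col_apply,
    Matrix.of_apply, Pi.smul_apply, Pi.single_apply, smul_eq_mul]
  fin_cases i <;> fin_cases j <;> simp [yCoeff, yNext]

/-- The weights of the basis vectors with respect to `[X, Y]`. -/
def weight : Fin 10 → ℤ := ![-3, -1, 1, 3, 3, 1, -1, -3, 0, 0]

theorem commutator_stdVec (i : Fin 10) :
    (Xop ∘ₗ Yop - Yop ∘ₗ Xop) (stdVec i) = (weight i : ℝ) • stdVec i := by
  simp only [LinearMap.sub_apply, LinearMap.comp_apply, Xop_stdVec, Yop_stdVec, map_smul,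
    smul_smul]
  fin_cases i <;> simp [xCoeff, yCoeff, xNext, yNext, weight, ← sub_smul] <;> norm_num

theorem apply_stdVec_eq_zero_of_weight_ne_zero {k : ℕ} {ω : V10 [⋀^Fin k]→ₗ[ℝ] ℝ}
    (hω : IsInv ω) (t : Fin k → Fin 10) (ht : ∑ i, weight (t i) ≠ 0) :
    ω (fun i => stdVec (t i)) = 0 := by
  have h := hω.1.commutator hω.2 fun i => stdVec (t i)
  simp only [commutator_stdVec, AlternatingMap.map_update_smul, Function.update_eq_self,
    smul_eq_mul, ← Finset.sum_mul] at h
  exact (mul_eq_zero.1 h).resolve_left (by exact_mod_cast ht)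

/-- The invariant alternating `n`-forms that are horizontal with respect to `p` and `q`. -/
noncomputable def invHorizontal (n : ℕ) : Submodule ℝ (V10 [⋀^Fin n]→ₗ[ℝ] ℝ) :=
  invSubmodule n ⊓ horizontal (stdVec 8) n ⊓ horizontal (stdVec 9) n

theorem mem_invSubmodule_iff {n : ℕ} {ω : V10 [⋀^Fin n]→ₗ[ℝ] ℝ} :
    ω ∈ invSubmodule n ↔ lieDeriv Xop ω = 0 ∧ lieDeriv Yop ω = 0 := by
  rw [lieDeriv_eq_zero_iff, lieDeriv_eq_zero_iff]
  rfl

theorem LieDerivZero.curryLeft {n : ℕ} {A : V10 →ₗ[ℝ] V10} {u : V10} (hu : A u = 0)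
    {ω : V10 [⋀^Fin (n + 1)]→ₗ[ℝ] ℝ} (hω : LieDerivZero A ω) :
    LieDerivZero A (ω.curryLeft u) := by
  intro v
  have h := hω (Matrix.vecCons u v)
  rw [Fin.sum_univ_succ, Matrix.cons_val_zero, hu, AlternatingMap.map_update_zero, zero_add] at h
  rw [← h]
  refine Finset.sum_congr rfl fun i _ => ?_
  rw [AlternatingMap.curryLeft_apply_apply, Matrix.cons_val_succ]
  exact congrArg ω (Fin.cons_update ..)

theorem curryLeft_mem_invSubmodule {n : ℕ} {u : V10} (hX : Xop u = 0) (hY : Yop u = 0)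
    {ω : V10 [⋀^Fin (n + 1)]→ₗ[ℝ] ℝ} (hω : ω ∈ invSubmodule (n + 1)) :
    ω.curryLeft u ∈ invSubmodule n :=
  ⟨hω.1.curryLeft hX, hω.2.curryLeft hY⟩

theorem covecWedge_mem_invSubmodule {n : ℕ} {ξ : V10 →ₗ[ℝ] ℝ} (hX : ξ ∘ₗ Xop = 0)
    (hY : ξ ∘ₗ Yop = 0) {η : V10 [⋀^Fin n]→ₗ[ℝ] ℝ} (hη : η ∈ invSubmodule n) :
    covecWedge ξ η ∈ invSubmodule (n + 1) := by
  rw [mem_invSubmodule_iff] at hη ⊢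
  rw [lieDeriv_covecWedge_of_lieDeriv_eq_zero hη.1, lieDeriv_covecWedge_of_lieDeriv_eq_zero hη.2,
    hX, hY, covecWedge_zero_left]
  exact ⟨rfl, rfl⟩

theorem dual_comp_Xop (i : Fin 10) :
    dual i ∘ₗ Xop = ((![0, 1, 2, 3, -3, -2, -1, 0, 0, 0] i : ℤ) : ℝ) • dual (yNext i) := by
  refine linearMap_ext_stdVec fun j => ?_
  have h : ∀ i j, xCoeff j * (if i = xNext j then 1 else 0) =
      ![0, 1, 2, 3, -3, -2, -1, 0, 0, 0] i * (if yNext i = j then 1 else 0) := by decide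
  simp only [LinearMap.comp_apply, Xop_stdVec, map_smul, LinearMap.smul_apply, dual_stdVec,
    smul_eq_mul]
  exact_mod_cast congrArg (Int.cast : ℤ → ℝ) (h i j)

theorem dual_comp_Yop (i : Fin 10) :
    dual i ∘ₗ Yop = ((![3, 2, 1, 0, 0, -1, -2, -3, 0, 0] i : ℤ) : ℝ) • dual (xNext i) := by
  refine linearMap_ext_stdVec fun j => ?_
  have h : ∀ i j, yCoeff j * (if i = yNext j then 1 else 0) =
      ![3, 2, 1, 0, 0, -1, -2, -3, 0, 0] i * (if xNext i = j then 1 else 0) := by decide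
  simp only [LinearMap.comp_apply, Yop_stdVec, map_smul, LinearMap.smul_apply, dual_stdVec,
    smul_eq_mul]
  exact_mod_cast congrArg (Int.cast : ℤ → ℝ) (h i j)

theorem finrank_invSubmodule_succ (n : ℕ) : Module.finrank ℝ (invSubmodule (n + 1)) =
    Module.finrank ℝ ↥(invSubmodule (n + 1) ⊓ horizontal (stdVec 8) (n + 1)) +
      Module.finrank ℝ ↥(invSubmodule n ⊓ horizontal (stdVec 8) n) :=
  finrank_eq_add_of_curryLeft_covecWedge invSubmodule (ξ := dual 8) (by simp [dual_stdVec]) n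
    (fun _ => curryLeft_mem_invSubmodule (by simp [Xop_stdVec, xCoeff])
      (by simp [Yop_stdVec, yCoeff]))
    fun _ => covecWedge_mem_invSubmodule (by simp [dual_comp_Xop]) (by simp [dual_comp_Yop])

theorem finrank_invSubmodule_inf_horizontal_succ (n : ℕ) :
    Module.finrank ℝ ↥(invSubmodule (n + 1) ⊓ horizontal (stdVec 8) (n + 1)) =
      Module.finrank ℝ (invHorizontal (n + 1)) + Module.finrank ℝ (invHorizontal n) :=
  finrank_eq_add_of_curryLeft_covecWedge (fun n => invSubmodule n ⊓ horizontal (stdVec 8) n)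
    (ξ := dual 9) (by simp [dual_stdVec]) n
    (fun _ h => ⟨curryLeft_mem_invSubmodule (by simp [Xop_stdVec, xCoeff])
      (by simp [Yop_stdVec, yCoeff]) h.1, curryLeft_mem_horizontal h.2⟩)
    fun _ h => ⟨covecWedge_mem_invSubmodule (by simp [dual_comp_Xop]) (by simp [dual_comp_Yop]) h.1,
      covecWedge_mem_horizontal (by simp [dual_stdVec]) h.2⟩

theorem eq_zero_of_mem_invHorizontal {n : ℕ} {ω : V10 [⋀^Fin n]→ₗ[ℝ] ℝ}
    (hω : ω ∈ invHorizontal n)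
    (h : ∀ t : Fin n → Fin 10, StrictMono t → (∀ i, t i < 8) → ∑ i, weight (t i) = 0 →
      ω (fun i => stdVec (t i)) = 0) : ω = 0 := by
  refine (Pi.basisFun ℝ (Fin 10)).ext_alternating fun t ht => ?_
  simp only [Pi.basisFun_apply, AlternatingMap.zero_apply]
  have hs : StrictMono (t ∘ Tuple.sort t) :=
    (Tuple.monotone_sort t).strictMono_of_injective (ht.comp (Tuple.sort t).injective)
  suffices ω (fun i => stdVec ((t ∘ Tuple.sort t) i)) = 0 by
    have hp := ω.map_perm (fun i => stdVec (t i)) (Tuple.sort t)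
    rw [show (fun i => stdVec (t i)) ∘ Tuple.sort t =
      fun i => stdVec ((t ∘ Tuple.sort t) i) from rfl, this] at hp
    exact (smul_eq_zero_iff_eq _).1 hp.symm
  generalize t ∘ Tuple.sort t = s at hs
  by_cases h8 : ∃ i, s i = 8
  · obtain ⟨i, hi⟩ := h8
    exact hω.1.2 _ i (by rw [hi])
  by_cases h9 : ∃ i, s i = 9
  · obtain ⟨i, hi⟩ := h9
    exact hω.2 _ i (by rw [hi])
  by_cases hw : ∑ i, weight (s i) = 0
  · exact h s hs (fun i => by have := not_exists.1 h8 i; have := not_exists.1 h9 i; omega) hw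
  · exact apply_stdVec_eq_zero_of_weight_ne_zero hω.1.1 s hw

theorem invHorizontal_eq_bot_of_odd {n : ℕ} (hn : Odd n) : invHorizontal n = ⊥ := by
  refine (Submodule.eq_bot_iff _).2 fun ω hω => eq_zero_of_mem_invHorizontal hω
    fun t _ ht hw => absurd hw fun hw => ?_
  have hodd : ∀ i : Fin 10, i < 8 → (weight i : ZMod 2) = 1 := by decide
  have h := congrArg (Int.cast : ℤ → ZMod 2) hw
  rw [Int.cast_sum, Finset.sum_congr rfl fun i _ => hodd _ (ht i)] at h
  simp only [Finset.sum_const, Finset.card_univ, Fintype.card_fin, nsmul_eq_mul, mul_one,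
    Int.cast_zero, ZMod.natCast_eq_zero_iff_even] at h
  exact Nat.not_even_iff_odd.2 hn h

theorem finrank_eq_one_of_eq_top {S : Submodule ℝ (V10 [⋀^Fin 0]→ₗ[ℝ] ℝ)} (hS : S = ⊤) :
    Module.finrank ℝ S = 1 := by
  rw [hS, finrank_top, ← (AlternatingMap.constLinearEquivOfIsEmpty (R' := ℝ) (M'' := V10)
    (N'' := ℝ) (ι := Fin 0)).finrank_eq, Module.finrank_self]

theorem invSubmodule_zero : invSubmodule 0 = ⊤ :=
  eq_top_iff.2 fun _ _ => ⟨fun _ => rfl, fun _ => rfl⟩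

theorem horizontal_zero (u : V10) : horizontal u 0 = ⊤ :=
  eq_top_iff.2 fun _ _ _ i => i.elim0

theorem invHorizontal_zero : invHorizontal 0 = ⊤ := by
  simp [invHorizontal, invSubmodule_zero, horizontal_zero]

/-- Exterior multiplication by the three invariant `2`-forms `e₀* ∧ e₃* - 3 e₁* ∧ e₂*`,
`f₀* ∧ f₃* - 3 f₁* ∧ f₂*` and `e₀* ∧ f₀* + 3 e₁* ∧ f₁* + 3 e₂* ∧ f₂* + e₃* ∧ f₃*`. -/
noncomputable def invWedge {n : ℕ} (i : Fin 3) (η : V10 [⋀^Fin n]→ₗ[ℝ] ℝ) :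
    V10 [⋀^Fin (n + 2)]→ₗ[ℝ] ℝ :=
  ![covecWedge (dual 0) (covecWedge (dual 3) η) -
      (3 : ℝ) • covecWedge (dual 1) (covecWedge (dual 2) η),
    covecWedge (dual 4) (covecWedge (dual 7) η) -
      (3 : ℝ) • covecWedge (dual 5) (covecWedge (dual 6) η),
    covecWedge (dual 0) (covecWedge (dual 4) η) +
      (3 : ℝ) • covecWedge (dual 1) (covecWedge (dual 5) η) +
      (3 : ℝ) • covecWedge (dual 2) (covecWedge (dual 6) η) +
      covecWedge (dual 3) (covecWedge (dual 7) η)] i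

theorem invWedge_mem_horizontal {n : ℕ} (i : Fin 3) {k : Fin 10} (hk : 8 ≤ k)
    {η : V10 [⋀^Fin n]→ₗ[ℝ] ℝ} (hη : η ∈ horizontal (stdVec k) n) :
    invWedge i η ∈ horizontal (stdVec k) (n + 2) := by
  have h : ∀ a b : Fin 10, a < 8 → b < 8 →
      covecWedge (dual a) (covecWedge (dual b) η) ∈ horizontal (stdVec k) (n + 2) :=
    fun a b ha hb => covecWedge_mem_horizontal (by simp [dual_stdVec, (ha.trans_le hk).ne])
      (covecWedge_mem_horizontal (by simp [dual_stdVec, (hb.trans_le hk).ne]) hη)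
  fin_cases i
  · exact sub_mem (h 0 3 (by decide) (by decide))
      (Submodule.smul_mem _ _ (h 1 2 (by decide) (by decide)))
  · exact sub_mem (h 4 7 (by decide) (by decide))
      (Submodule.smul_mem _ _ (h 5 6 (by decide) (by decide)))
  · exact add_mem (add_mem (add_mem (h 0 4 (by decide) (by decide))
      (Submodule.smul_mem _ _ (h 1 5 (by decide) (by decide))))
      (Submodule.smul_mem _ _ (h 2 6 (by decide) (by decide))))
      (h 3 7 (by decide) (by decide))

theorem invWedge_mem_invSubmodule {n : ℕ} (i : Fin 3) {η : V10 [⋀^Fin n]→ₗ[ℝ] ℝ}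
    (hη : η ∈ invSubmodule n) : invWedge i η ∈ invSubmodule (n + 2) := by
  rw [mem_invSubmodule_iff] at hη ⊢
  constructor
  · fin_cases i <;> ext v <;>
      simp [invWedge, lieDeriv_covecWedge_covecWedge hη.1, dual_comp_Xop, yNext, covecWedge_zero_left,
        covecWedge_smul_left, covecWedge_self]
  · fin_cases i <;> ext v <;>
      simp [invWedge, lieDeriv_covecWedge_covecWedge hη.2, dual_comp_Yop, xNext, covecWedge_zero_left,
        covecWedge_smul_left, covecWedge_self]

theorem invWedge_mem_invHorizontal {n : ℕ} (i : Fin 3) {η : V10 [⋀^Fin n]→ₗ[ℝ] ℝ}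
    (hη : η ∈ invHorizontal n) : invWedge i η ∈ invHorizontal (n + 2) :=
  ⟨⟨invWedge_mem_invSubmodule i hη.1.1, invWedge_mem_horizontal i le_rfl hη.1.2⟩,
    invWedge_mem_horizontal i (by decide) hη.2⟩

theorem covecWedge_vec_one (ξ : V10 →ₗ[ℝ] ℝ) (η : V10 [⋀^Fin 0]→ₗ[ℝ] ℝ) (a : V10) :
    covecWedge ξ η ![a] = ξ a * η ![] := by
  rw [covecWedge_apply]
  simp [Subsingleton.elim _ (![] : Fin 0 → V10)]

theorem covecWedge_vec_two (ξ : V10 →ₗ[ℝ] ℝ) (η : V10 [⋀^Fin 1]→ₗ[ℝ] ℝ) (a b : V10) :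
    covecWedge ξ η ![a, b] = ξ a * η ![b] - ξ b * η ![a] := by
  rw [covecWedge_apply, Fin.sum_univ_two,
    show Fin.removeNth 0 ![a, b] = ![b] by ext i : 1; fin_cases i; rfl,
    show Fin.removeNth 1 ![a, b] = ![a] by ext i : 1; fin_cases i; rfl]
  simp [sub_eq_add_neg]

theorem covecWedge_vec_three (ξ : V10 →ₗ[ℝ] ℝ) (η : V10 [⋀^Fin 2]→ₗ[ℝ] ℝ) (a b c : V10) :
    covecWedge ξ η ![a, b, c] = ξ a * η ![b, c] - ξ b * η ![a, c] + ξ c * η ![a, b] := by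
  rw [covecWedge_apply, Fin.sum_univ_three,
    show Fin.removeNth 0 ![a, b, c] = ![b, c] by ext i : 1; fin_cases i <;> rfl,
    show Fin.removeNth 1 ![a, b, c] = ![a, c] by ext i : 1; fin_cases i <;> rfl,
    show Fin.removeNth 2 ![a, b, c] = ![a, b] by ext i : 1; fin_cases i <;> rfl]
  simp [sub_eq_add_neg]

theorem covecWedge_vec_four (ξ : V10 →ₗ[ℝ] ℝ) (η : V10 [⋀^Fin 3]→ₗ[ℝ] ℝ) (a b c d : V10) :
    covecWedge ξ η ![a, b, c, d] =
      ξ a * η ![b, c, d] - ξ b * η ![a, c, d] + ξ c * η ![a, b, d] - ξ d * η ![a, b, c] := by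
  rw [covecWedge_apply, Fin.sum_univ_four,
    show Fin.removeNth 0 ![a, b, c, d] = ![b, c, d] by ext i : 1; fin_cases i <;> rfl,
    show Fin.removeNth 1 ![a, b, c, d] = ![a, c, d] by ext i : 1; fin_cases i <;> rfl,
    show Fin.removeNth 2 ![a, b, c, d] = ![a, b, d] by ext i : 1; fin_cases i <;> rfl,
    show Fin.removeNth 3 ![a, b, c, d] = ![a, b, c] by ext i : 1; fin_cases i <;> rfl]
  simp [sub_eq_add_neg, pow_succ]

/-- The constant `0`-form `1`. -/
noncomputable def unitForm : V10 [⋀^Fin 0]→ₗ[ℝ] ℝ := AlternatingMap.constOfIsEmpty ℝ V10 (Fin 0) 1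

theorem unitForm_mem : unitForm ∈ invHorizontal 0 := invHorizontal_zero ▸ Submodule.mem_top

/-- The value of a `2`-form on two basis vectors. -/
noncomputable def coordTwo (a b : Fin 10) : (V10 [⋀^Fin 2]→ₗ[ℝ] ℝ) →ₗ[ℝ] ℝ where
  toFun ω := ω ![stdVec a, stdVec b]
  map_add' _ _ := rfl
  map_smul' _ _ := rfl

/-- The value of a `4`-form on four basis vectors. -/
noncomputable def coordFour (a b c d : Fin 10) : (V10 [⋀^Fin 4]→ₗ[ℝ] ℝ) →ₗ[ℝ] ℝ where
  toFun ω := ω ![stdVec a, stdVec b, stdVec c, stdVec d]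
  map_add' _ _ := rfl
  map_smul' _ _ := rfl

theorem coordFour_eq_zero_left (a c d : Fin 10) (ω : V10 [⋀^Fin 4]→ₗ[ℝ] ℝ) :
    coordFour a a c d ω = 0 :=
  ω.map_eq_zero_of_eq ![stdVec a, stdVec a, stdVec c, stdVec d] (i := 0) (j := 1) rfl (by decide)

theorem coordFour_eq_zero_mid (a b d : Fin 10) (ω : V10 [⋀^Fin 4]→ₗ[ℝ] ℝ) :
    coordFour a b b d ω = 0 :=
  ω.map_eq_zero_of_eq ![stdVec a, stdVec b, stdVec b, stdVec d] (i := 1) (j := 2) rfl (by decide)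

theorem coordFour_eq_zero_right (a b c : Fin 10) (ω : V10 [⋀^Fin 4]→ₗ[ℝ] ℝ) :
    coordFour a b c c ω = 0 :=
  ω.map_eq_zero_of_eq ![stdVec a, stdVec b, stdVec c, stdVec c] (i := 2) (j := 3) rfl (by decide)

theorem coordTwo_Xop {ω : V10 [⋀^Fin 2]→ₗ[ℝ] ℝ} (hω : LieDerivZero Xop ω) (a b : Fin 10) :
    xCoeff a * coordTwo (xNext a) b ω + xCoeff b * coordTwo a (xNext b) ω = 0 := by
  have h := hω ![stdVec a, stdVec b]
  rw [Fin.sum_univ_two] at h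
  simp only [Matrix.cons_val, Xop_stdVec, AlternatingMap.map_update_smul, smul_eq_mul] at h
  have hupd : ∀ (i : Fin 2) (x : V10), Function.update ![stdVec a, stdVec b] i x =
      ![if i = 0 then x else stdVec a, if i = 1 then x else stdVec b] := fun i x => by
    ext j : 1; fin_cases i <;> fin_cases j <;> rfl
  simpa [coordTwo, hupd] using h

theorem coordFour_Xop {ω : V10 [⋀^Fin 4]→ₗ[ℝ] ℝ} (hω : LieDerivZero Xop ω) (a b c d : Fin 10) :
    xCoeff a * coordFour (xNext a) b c d ω + xCoeff b * coordFour a (xNext b) c d ω +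
      xCoeff c * coordFour a b (xNext c) d ω + xCoeff d * coordFour a b c (xNext d) ω = 0 := by
  have h := hω ![stdVec a, stdVec b, stdVec c, stdVec d]
  rw [Fin.sum_univ_four] at h
  simp only [Matrix.cons_val, Xop_stdVec, AlternatingMap.map_update_smul, smul_eq_mul] at h
  have hupd : ∀ (i : Fin 4) (x : V10),
      Function.update ![stdVec a, stdVec b, stdVec c, stdVec d] i x =
        ![if i = 0 then x else stdVec a, if i = 1 then x else stdVec b,
          if i = 2 then x else stdVec c, if i = 3 then x else stdVec d] := fun i x => by
    ext j : 1; fin_cases i <;> fin_cases j <;> rfl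
  simpa [coordFour, hupd] using h

/-- The coordinates that determine an element of `invHorizontal 2`. -/
noncomputable def freeCoordTwo : (V10 [⋀^Fin 2]→ₗ[ℝ] ℝ) →ₗ[ℝ] Fin 3 → ℝ :=
  LinearMap.pi ![coordTwo 1 2, coordTwo 5 6, coordTwo 3 7]

theorem eq_zero_of_freeCoordTwo_eq_zero {ω : V10 [⋀^Fin 2]→ₗ[ℝ] ℝ} (hω : ω ∈ invHorizontal 2)
    (h : freeCoordTwo ω = 0) : ω = 0 := by
  have h0 := congrFun h 0
  have h1 := congrFun h 1
  have h2 := congrFun h 2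
  simp only [freeCoordTwo, LinearMap.pi_apply, Matrix.cons_val, Pi.zero_apply] at h0 h1 h2
  have eX := coordTwo_Xop hω.1.1.1
  have e0 := eX 0 2
  have e1 := eX 0 5
  have e2 := eX 1 6
  have e3 := eX 2 7
  have e4 := eX 5 7
  simp [xCoeff, xNext] at e0 e1 e2 e3 e4
  refine eq_zero_of_mem_invHorizontal hω fun t ht ht8 hw => ?_
  have hvec : (fun i => stdVec (t i)) = ![stdVec (t 0), stdVec (t 1)] := by
    ext i : 1; fin_cases i <;> rfl
  have hcases : ∀ a b : Fin 10, a < b → b < 8 → weight a + weight b = 0 →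
      (a, b) ∈ [(0, 3), (0, 4), (1, 2), (1, 5), (2, 6), (3, 7), (4, 7), (5, 6)] := by decide
  rw [Fin.sum_univ_two] at hw
  have hmem := hcases _ _ (ht (show (0 : Fin 2) < 1 by decide)) (ht8 1) hw
  rw [hvec]
  change coordTwo (t 0) (t 1) ω = 0
  generalize t 0 = a, t 1 = b at hmem
  simp only [List.mem_cons, Prod.mk.injEq, List.not_mem_nil, or_false] at hmem
  rcases hmem with ⟨rfl, rfl⟩ | ⟨rfl, rfl⟩ | ⟨rfl, rfl⟩ | ⟨rfl, rfl⟩ | ⟨rfl, rfl⟩ | ⟨rfl, rfl⟩ |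
    ⟨rfl, rfl⟩ | ⟨rfl, rfl⟩ <;> linarith

/-- The coordinates that determine an element of `invHorizontal 4`. -/
noncomputable def freeCoordFour : (V10 [⋀^Fin 4]→ₗ[ℝ] ℝ) →ₗ[ℝ] Fin 6 → ℝ :=
  LinearMap.pi ![coordFour 0 1 2 3, coordFour 4 5 6 7, coordFour 1 2 5 6, coordFour 1 2 3 7,
    coordFour 3 5 6 7, coordFour 2 3 6 7]

theorem eq_zero_of_freeCoordFour_eq_zero {ω : V10 [⋀^Fin 4]→ₗ[ℝ] ℝ} (hω : ω ∈ invHorizontal 4)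
    (h : freeCoordFour ω = 0) : ω = 0 := by
  have h0 := congrFun h 0
  have h1 := congrFun h 1
  have h2 := congrFun h 2
  have h3 := congrFun h 3
  have h4 := congrFun h 4
  have h5 := congrFun h 5
  simp only [freeCoordFour, LinearMap.pi_apply, Matrix.cons_val, Pi.zero_apply]
    at h0 h1 h2 h3 h4 h5
  have eX := coordFour_Xop hω.1.1.1
  have e0 := eX 0 1 2 5
  have e1 := eX 0 1 3 6
  have e2 := eX 0 1 4 6
  have e3 := eX 0 2 3 7
  have e4 := eX 0 2 4 7
  have e5 := eX 0 2 5 6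
  have e6 := eX 0 3 5 7
  have e7 := eX 0 4 5 7
  have e8 := eX 1 2 5 7
  have e9 := eX 1 3 6 7
  have e10 := eX 1 4 6 7
  have e11 := eX 2 5 6 7
  simp [xCoeff, xNext, coordFour_eq_zero_left, coordFour_eq_zero_mid, coordFour_eq_zero_right]
    at e0 e1 e2 e3 e4 e5 e6 e7 e8 e9 e10 e11
  refine eq_zero_of_mem_invHorizontal hω fun t ht ht8 hw => ?_
  have hvec : (fun i => stdVec (t i)) =
      ![stdVec (t 0), stdVec (t 1), stdVec (t 2), stdVec (t 3)] := by
    ext i : 1; fin_cases i <;> rfl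
  have hcases : ∀ a b : Fin 10, a < b → ∀ c, b < c → ∀ d, c < d → d < 8 →
      weight a + weight b + weight c + weight d = 0 →
      (a, b, c, d) ∈ [(0, 1, 2, 3), (0, 1, 2, 4), (0, 1, 3, 5), (0, 1, 4, 5), (0, 2, 3, 6),
        (0, 2, 4, 6), (0, 3, 4, 7), (0, 3, 5, 6), (0, 4, 5, 6), (1, 2, 3, 7), (1, 2, 4, 7),
        (1, 2, 5, 6), (1, 3, 5, 7), (1, 4, 5, 7), (2, 3, 6, 7), (2, 4, 6, 7), (3, 5, 6, 7),
        (4, 5, 6, 7)] := by decide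
  rw [Fin.sum_univ_four] at hw
  have hmem := hcases _ _ (ht (show (0 : Fin 4) < 1 by decide)) _
    (ht (show (1 : Fin 4) < 2 by decide)) _ (ht (show (2 : Fin 4) < 3 by decide)) (ht8 3) hw
  rw [hvec]
  change coordFour (t 0) (t 1) (t 2) (t 3) ω = 0
  generalize t 0 = a, t 1 = b, t 2 = c, t 3 = d at hmem
  simp only [List.mem_cons, Prod.mk.injEq, List.not_mem_nil, or_false] at hmem
  rcases hmem with ⟨rfl, rfl, rfl, rfl⟩ | ⟨rfl, rfl, rfl, rfl⟩ | ⟨rfl, rfl, rfl, rfl⟩ |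
    ⟨rfl, rfl, rfl, rfl⟩ | ⟨rfl, rfl, rfl, rfl⟩ | ⟨rfl, rfl, rfl, rfl⟩ | ⟨rfl, rfl, rfl, rfl⟩ |
    ⟨rfl, rfl, rfl, rfl⟩ | ⟨rfl, rfl, rfl, rfl⟩ | ⟨rfl, rfl, rfl, rfl⟩ | ⟨rfl, rfl, rfl, rfl⟩ |
    ⟨rfl, rfl, rfl, rfl⟩ | ⟨rfl, rfl, rfl, rfl⟩ | ⟨rfl, rfl, rfl, rfl⟩ | ⟨rfl, rfl, rfl, rfl⟩ |
    ⟨rfl, rfl, rfl, rfl⟩ | ⟨rfl, rfl, rfl, rfl⟩ | ⟨rfl, rfl, rfl, rfl⟩ <;> linarith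

/-- If `d` coordinates determine the elements of `S`, and `S` contains `d` forms on which these
coordinates are linearly independent, then `S` has dimension `d`. -/
theorem finrank_eq_of_coordinates {E : Type*} [AddCommGroup E] [Module ℝ E]
    [FiniteDimensional ℝ E] {S : Submodule ℝ E} {d : ℕ} (L : E →ₗ[ℝ] Fin d → ℝ)
    (hL : ∀ x ∈ S, L x = 0 → x = 0) (b : Fin d → E) (hb : ∀ i, b i ∈ S)
    (hind : LinearIndependent ℝ fun i => L (b i)) : Module.finrank ℝ S = d := by
  refine le_antisymm ?_ ?_
  · have hinj : Function.Injective (L.domRestrict S) :=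
      (injective_iff_map_eq_zero _).2 fun x hx => Subtype.ext (hL x x.2 hx)
    simpa using LinearMap.finrank_le_finrank_of_injective hinj
  · have h : LinearIndependent ℝ fun i => (⟨b i, hb i⟩ : S) :=
      LinearIndependent.of_comp (L.domRestrict S) hind
    simpa using h.fintype_card_le_finrank

theorem finrank_invHorizontal_two : Module.finrank ℝ (invHorizontal 2) = 3 := by
  refine finrank_eq_of_coordinates freeCoordTwo (fun _ => eq_zero_of_freeCoordTwo_eq_zero)
    (fun i => invWedge i unitForm) (fun i => invWedge_mem_invHorizontal i unitForm_mem) ?_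
  rw [Fintype.linearIndependent_iff]
  intro g hg
  have h0 := congrFun hg 0
  have h1 := congrFun hg 1
  have h2 := congrFun hg 2
  simp [Fin.sum_univ_three, freeCoordTwo, coordTwo, invWedge, covecWedge_vec_two,
    covecWedge_vec_one, dual_stdVec, unitForm] at h0 h1 h2
  intro i
  fin_cases i <;> assumption

theorem finrank_invHorizontal_four : Module.finrank ℝ (invHorizontal 4) = 6 := by
  refine finrank_eq_of_coordinates freeCoordFour (fun _ => eq_zero_of_freeCoordFour_eq_zero)
    (fun i => invWedge (![0, 1, 0, 0, 1, 2] i) (invWedge (![0, 1, 1, 2, 2, 2] i) unitForm))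
    (fun i => invWedge_mem_invHorizontal _ (invWedge_mem_invHorizontal _ unitForm_mem)) ?_
  rw [Fintype.linearIndependent_iff]
  intro g hg
  have h0 := congrFun hg 0
  have h1 := congrFun hg 1
  have h2 := congrFun hg 2
  have h3 := congrFun hg 3
  have h4 := congrFun hg 4
  have h5 := congrFun hg 5
  simp [Fin.sum_univ_six, freeCoordFour, coordFour, invWedge, covecWedge_vec_four,
    covecWedge_vec_three, covecWedge_vec_two, covecWedge_vec_one, dual_stdVec, unitForm]
    at h0 h1 h2 h3 h4 h5
  norm_num at h0 h1
  intro i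
  fin_cases i <;> simp <;> linarith

/-- **dimension statement of Corollary 4.1.** For `k = 1, 2, 3, 4, 5`, the
space of invariant alternating `k`-forms on `V` has dimension `2, 4, 6, 9, 12`
respectively. -/
theorem stmt15 :
    Module.finrank ℝ (invSubmodule 1) = 2 ∧
    Module.finrank ℝ (invSubmodule 2) = 4 ∧
    Module.finrank ℝ (invSubmodule 3) = 6 ∧
    Module.finrank ℝ (invSubmodule 4) = 9 ∧
    Module.finrank ℝ (invSubmodule 5) = 12 := by
  have h0 := finrank_eq_one_of_eq_top invHorizontal_zero
  have h0' := finrank_eq_one_of_eq_top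
    (S := invSubmodule 0 ⊓ horizontal (stdVec 8) 0) (by simp [invSubmodule_zero, horizontal_zero])
  have h2 := finrank_invHorizontal_two
  have h4 := finrank_invHorizontal_four
  have hodd : ∀ n, Odd n → Module.finrank ℝ (invHorizontal n) = 0 := fun n hn => by
    rw [invHorizontal_eq_bot_of_odd hn, finrank_bot]
  have h1 := hodd 1 (by decide)
  have h3 := hodd 3 (by decide)
  have h5 := hodd 5 (by decide)
  norm_num [finrank_invSubmodule_succ, finrank_invSubmodule_inf_horizontal_succ, h0, h0', h1, h2,
    h3, h4, h5]
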